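/- For every integer n ≥ 3, in the set S_n(123,231,312): f_{132}(S_n(123,231,312)) = f_{213}(S_n(123,231,312)) = binom(n+1, 4), and 12·f_{321}(S_n(123,231,312)) = n(n−2)(n−1)² (i.e., f_{321}(S_n(123,231,312)) = n(n−2)(n−1)²/12). -/

import Mathlib

open Finset

/-- Number of occurrences of the length-3 pattern `q` (given by its sequence of values)
in the permutation `σ` of `Fin n`: triples of indices `ι 0 < ι 1 < ι 2` whose values under
`σ` are in the same relative order as the values of `q`. -/
def occ (n : ℕ) (q : Fin 3 → ℕ) (σ : Equiv.Perm (Fin n)) : ℕ :=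
  (Finset.univ.filter fun ι : Fin 3 → Fin n =>
    (∀ j l : Fin 3, j < l → ι j < ι l) ∧
    (∀ j l : Fin 3, q j < q l ↔ σ (ι j) < σ (ι l))).card

/-- The set `S_n(R)` of permutations of `{1,…,n}` avoiding every pattern in `R`. -/
def avoiders (n : ℕ) (R : List (Fin 3 → ℕ)) : Finset (Equiv.Perm (Fin n)) :=
  Finset.univ.filter fun σ => ∀ q ∈ R, occ n q σ = 0

/-- `f_q(S_n(R))`: the total number of occurrences of the pattern `q` among
all permutations in `S_n(R)`. -/
def fCnt (n : ℕ) (q : Fin 3 → ℕ) (R : List (Fin 3 → ℕ)) : ℕ :=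
  ∑ σ ∈ avoiders n R, occ n q σ

def p123 : Fin 3 → ℕ := ![1, 2, 3]
def p132 : Fin 3 → ℕ := ![1, 3, 2]
def p213 : Fin 3 → ℕ := ![2, 1, 3]
def p231 : Fin 3 → ℕ := ![2, 3, 1]
def p312 : Fin 3 → ℕ := ![3, 1, 2]
def p321 : Fin 3 → ℕ := ![3, 2, 1]

theorem Fin.val_sub_eq_ite {n : ℕ} (a b : Fin n) :
    (a - b).val = if b.val ≤ a.val then a.val - b.val else n + a.val - b.val := by
  split_ifs with h
  · exact Fin.coe_sub_iff_le.2 h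
  · exact Fin.coe_sub_iff_lt.2 (not_le.1 h)

/-- The strictly increasing sequences of length `k` in `Fin N`. -/
def increasingSeqs (k N : ℕ) : Finset (Fin k → Fin N) :=
  Finset.univ.filter fun f => StrictMono f

theorem card_increasingSeqs (k N : ℕ) : (increasingSeqs k N).card = N.choose k := by
  have e : {f : Fin k → Fin N // StrictMono f} ≃ (Fin k ↪o Fin N) :=
    { toFun f := OrderEmbedding.ofStrictMono f.1 f.2
      invFun f := ⟨f, f.strictMono⟩
      left_inv _ := rfl
      right_inv _ := by ext; rfl }
  rw [increasingSeqs, ← Fintype.card_subtype, Fintype.card_eq_nat_card,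
    Nat.card_congr (e.trans Set.powersetCard.ofFinEmbEquiv), Set.powersetCard.card, Nat.card_fin]

theorem mem_increasingSeqs_four {N : ℕ} {f : Fin 4 → Fin N} :
    f ∈ increasingSeqs 4 N ↔ f 0 < f 1 ∧ f 1 < f 2 ∧ f 2 < f 3 := by
  simp [increasingSeqs, Fin.strictMono_iff_lt_succ, Fin.forall_fin_succ]

theorem occ_eq_zero_iff {n : ℕ} {q : Fin 3 → ℕ} {σ : Equiv.Perm (Fin n)} :
    occ n q σ = 0 ↔ ∀ i j l : Fin n, i < j → j < l →
      ¬ ((q 0 < q 1 ↔ σ i < σ j) ∧ (q 1 < q 0 ↔ σ j < σ i) ∧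
         (q 0 < q 2 ↔ σ i < σ l) ∧ (q 2 < q 0 ↔ σ l < σ i) ∧
         (q 1 < q 2 ↔ σ j < σ l) ∧ (q 2 < q 1 ↔ σ l < σ j)) := by
  rw [occ, Finset.card_eq_zero, Finset.filter_eq_empty_iff]
  constructor
  · rintro h i j l hij hjl ⟨h1, h2, h3, h4, h5, h6⟩
    refine h (Finset.mem_univ ![i, j, l]) ⟨?_, ?_⟩
    · simp [Fin.forall_fin_succ, hij, hjl, hij.trans hjl]
    · simp [Fin.forall_fin_succ, h1, h2, h3, h4, h5, h6]
  · rintro h ι - ⟨h1, h2⟩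
    exact h (ι 0) (ι 1) (ι 2) (h1 _ _ (by decide)) (h1 _ _ (by decide))
      ⟨h2 _ _, h2 _ _, h2 _ _, h2 _ _, h2 _ _, h2 _ _⟩

/-- The permutations avoiding `123`, `231`, `312` are the reflections `i ↦ a - i` modulo `n`. -/
theorem mem_avoiders_iff {m : ℕ} {σ : Equiv.Perm (Fin (m + 1))} :
    σ ∈ avoiders (m + 1) [p123, p231, p312] ↔ ∃ a, Equiv.subLeft a = σ := by
  simp only [avoiders, Finset.mem_filter, Finset.mem_univ, true_and, List.mem_cons,
    List.not_mem_nil, or_false, forall_eq_or_imp, forall_eq, occ_eq_zero_iff]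
  constructor
  · rintro ⟨h1, h2, h3⟩
    have mono : StrictMono fun i => σ 0 - σ i := by
      intro j l hjl
      have hne : σ j ≠ σ l := σ.injective.ne hjl.ne
      have hl : σ 0 ≠ σ l := σ.injective.ne (by rintro rfl; exact absurd hjl (by simp))
      rcases eq_or_ne j 0 with rfl | hj
      · simpa [Fin.pos_iff_ne_zero, sub_eq_zero] using hl
      have hj' : σ 0 ≠ σ j := σ.injective.ne hj.symm
      have a1 := h1 0 j l (Fin.pos_iff_ne_zero.2 hj) hjl
      have a2 := h2 0 j l (Fin.pos_iff_ne_zero.2 hj) hjl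
      have a3 := h3 0 j l (Fin.pos_iff_ne_zero.2 hj) hjl
      simp only [Fin.lt_def, Fin.val_sub_eq_ite, ne_eq, Fin.ext_iff] at *
      simp [p123, p231, p312] at a1 a2 a3
      have := (σ j).isLt
      have := (σ l).isLt
      have := (σ 0).isLt
      split_ifs <;> omega
    have hid : (fun i => σ 0 - σ i) = id := mono.eq_id
    refine ⟨σ 0, Equiv.ext fun i => ?_⟩
    exact sub_eq_iff_eq_add.2 (sub_eq_iff_eq_add'.1 (congrFun hid i))
  · rintro ⟨a, rfl⟩
    refine ⟨?_, ?_, ?_⟩ <;> intro i j l hij hjl <;> rw [Fin.lt_def] at hij hjl <;>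
      simp only [Equiv.subLeft_apply, Fin.lt_def, Fin.val_sub_eq_ite] <;>
      simp [p123, p231, p312, -Fin.val_fin_le] <;>
      split_ifs <;> omega

theorem fCnt_eq_card {m : ℕ} (q : Fin 3 → ℕ) :
    fCnt (m + 1) q [p123, p231, p312] =
      (Finset.univ.filter fun x : Fin (m + 1) × (Fin 3 → Fin (m + 1)) =>
        (∀ j l : Fin 3, j < l → x.2 j < x.2 l) ∧
        (∀ j l : Fin 3, q j < q l ↔ x.1 - x.2 j < x.1 - x.2 l)).card := by
  have him : avoiders (m + 1) [p123, p231, p312] =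
      Finset.univ.image fun a : Fin (m + 1) => Equiv.subLeft a := by
    ext σ
    simp [mem_avoiders_iff]
  rw [fCnt, him, Finset.sum_image]
  · simp only [occ, Finset.card_filter, Equiv.subLeft_apply, Fintype.sum_prod_type]
  · intro a _ b _ h
    simpa using Equiv.congr_fun h 0

theorem pattern132_iff {n : ℕ} (a : Fin n) (ι : Fin 3 → Fin n) :
    ((∀ j l : Fin 3, j < l → ι j < ι l) ∧
      ∀ j l : Fin 3, p132 j < p132 l ↔ a - ι j < a - ι l) ↔
    ι 0 ≤ a ∧ a < ι 1 ∧ ι 1 < ι 2 := by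
  simp [p132, Fin.forall_fin_succ, Fin.lt_def, Fin.le_def, Fin.val_sub_eq_ite, -Fin.val_fin_lt, -Fin.val_fin_le]
  split_ifs <;> omega

theorem pattern213_iff {n : ℕ} (a : Fin n) (ι : Fin 3 → Fin n) :
    ((∀ j l : Fin 3, j < l → ι j < ι l) ∧
      ∀ j l : Fin 3, p213 j < p213 l ↔ a - ι j < a - ι l) ↔
    ι 0 < ι 1 ∧ ι 1 ≤ a ∧ a < ι 2 := by
  simp [p213, Fin.forall_fin_succ, Fin.lt_def, Fin.le_def, Fin.val_sub_eq_ite, -Fin.val_fin_lt, -Fin.val_fin_le]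
  split_ifs <;> omega

theorem pattern321_iff {n : ℕ} (a : Fin n) (ι : Fin 3 → Fin n) :
    ((∀ j l : Fin 3, j < l → ι j < ι l) ∧
      ∀ j l : Fin 3, p321 j < p321 l ↔ a - ι j < a - ι l) ↔
    (ι 0 < ι 1 ∧ ι 1 < ι 2 ∧ ι 2 ≤ a) ∨ (a < ι 0 ∧ ι 0 < ι 1 ∧ ι 1 < ι 2) := by
  simp [p321, Fin.forall_fin_succ, Fin.lt_def, Fin.le_def, Fin.val_sub_eq_ite, -Fin.val_fin_lt, -Fin.val_fin_le]
  split_ifs <;> omega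

theorem card_le_lt_lt (n : ℕ) :
    (Finset.univ.filter fun x : Fin n × (Fin 3 → Fin n) =>
      x.2 0 ≤ x.1 ∧ x.1 < x.2 1 ∧ x.2 1 < x.2 2).card = (n + 1).choose 4 := by
  rw [← card_increasingSeqs]
  refine Finset.card_bij
    (fun x _ => ![(x.2 0).castSucc, x.1.succ, (x.2 1).succ, (x.2 2).succ]) ?_ ?_ ?_
  · rintro ⟨a, ι⟩ h
    simpa [mem_increasingSeqs_four, Fin.lt_def, Fin.le_def, Nat.lt_succ_iff,
      -Fin.val_fin_lt, -Fin.val_fin_le] using h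
  · rintro ⟨a, ι⟩ - ⟨b, κ⟩ - h
    simp [funext_iff, Fin.forall_fin_succ] at h ⊢
    tauto
  · intro f hf
    rw [mem_increasingSeqs_four] at hf
    obtain ⟨h1, h2, h3⟩ := hf
    have hlast : f 0 ≠ Fin.last n := (h1.trans_le (Fin.le_last _)).ne
    have z1 : f 1 ≠ 0 := (h1.trans_le' (Fin.zero_le _)).ne'
    have z2 : f 2 ≠ 0 := (h2.trans_le' (Fin.zero_le _)).ne'
    have z3 : f 3 ≠ 0 := (h3.trans_le' (Fin.zero_le _)).ne'
    refine ⟨((f 1).pred z1, ![(f 0).castPred hlast, (f 2).pred z2, (f 3).pred z3]), ?_, ?_⟩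
    · simp [h2, h3]
      simp [Fin.le_def, Fin.lt_def, -Fin.val_fin_lt, -Fin.val_fin_le] at h1 ⊢
      omega
    · ext i
      fin_cases i <;> simp

theorem card_lt_le_lt (n : ℕ) :
    (Finset.univ.filter fun x : Fin n × (Fin 3 → Fin n) =>
      x.2 0 < x.2 1 ∧ x.2 1 ≤ x.1 ∧ x.1 < x.2 2).card = (n + 1).choose 4 := by
  rw [← card_increasingSeqs]
  refine Finset.card_bij
    (fun x _ => ![(x.2 0).castSucc, (x.2 1).castSucc, x.1.succ, (x.2 2).succ]) ?_ ?_ ?_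
  · rintro ⟨a, ι⟩ h
    simpa [mem_increasingSeqs_four, Fin.lt_def, Fin.le_def, Nat.lt_succ_iff,
      -Fin.val_fin_lt, -Fin.val_fin_le] using h
  · rintro ⟨a, ι⟩ - ⟨b, κ⟩ - h
    simp [funext_iff, Fin.forall_fin_succ] at h ⊢
    tauto
  · intro f hf
    rw [mem_increasingSeqs_four] at hf
    obtain ⟨h1, h2, h3⟩ := hf
    have l0 : f 0 ≠ Fin.last n := (h1.trans_le (Fin.le_last _)).ne
    have l1 : f 1 ≠ Fin.last n := (h2.trans_le (Fin.le_last _)).ne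
    have z2 : f 2 ≠ 0 := (h2.trans_le' (Fin.zero_le _)).ne'
    have z3 : f 3 ≠ 0 := (h3.trans_le' (Fin.zero_le _)).ne'
    refine ⟨((f 2).pred z2, ![(f 0).castPred l0, (f 1).castPred l1, (f 3).pred z3]), ?_, ?_⟩
    · simp [h1, h3]
      simp [Fin.le_def, Fin.lt_def, -Fin.val_fin_lt, -Fin.val_fin_le] at h2 ⊢
      omega
    · ext i
      fin_cases i <;> simp

theorem card_lt_lt_le (n : ℕ) :
    (Finset.univ.filter fun x : Fin n × (Fin 3 → Fin n) =>
      x.2 0 < x.2 1 ∧ x.2 1 < x.2 2 ∧ x.2 2 ≤ x.1).card = (n + 1).choose 4 := by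
  rw [← card_increasingSeqs]
  refine Finset.card_bij
    (fun x _ => ![(x.2 0).castSucc, (x.2 1).castSucc, (x.2 2).castSucc, x.1.succ]) ?_ ?_ ?_
  · rintro ⟨a, ι⟩ h
    simpa [mem_increasingSeqs_four, Fin.lt_def, Fin.le_def, Nat.lt_succ_iff,
      -Fin.val_fin_lt, -Fin.val_fin_le] using h
  · rintro ⟨a, ι⟩ - ⟨b, κ⟩ - h
    simp [funext_iff, Fin.forall_fin_succ] at h ⊢
    tauto
  · intro f hf
    rw [mem_increasingSeqs_four] at hf
    obtain ⟨h1, h2, h3⟩ := hf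
    have l0 : f 0 ≠ Fin.last n := (h1.trans_le (Fin.le_last _)).ne
    have l1 : f 1 ≠ Fin.last n := (h2.trans_le (Fin.le_last _)).ne
    have l2 : f 2 ≠ Fin.last n := (h3.trans_le (Fin.le_last _)).ne
    have z3 : f 3 ≠ 0 := (h3.trans_le' (Fin.zero_le _)).ne'
    refine ⟨((f 3).pred z3, ![(f 0).castPred l0, (f 1).castPred l1, (f 2).castPred l2]), ?_, ?_⟩
    · simp [h1, h2]
      simp [Fin.le_def, Fin.lt_def, -Fin.val_fin_lt, -Fin.val_fin_le] at h3 ⊢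
      omega
    · ext i
      fin_cases i <;> simp

theorem card_lt_lt_lt (n : ℕ) :
    (Finset.univ.filter fun x : Fin n × (Fin 3 → Fin n) =>
      x.1 < x.2 0 ∧ x.2 0 < x.2 1 ∧ x.2 1 < x.2 2).card = n.choose 4 := by
  rw [← card_increasingSeqs]
  refine Finset.card_bij (fun x _ => ![x.1, x.2 0, x.2 1, x.2 2]) ?_ ?_ ?_
  · rintro ⟨a, ι⟩ h
    simpa [mem_increasingSeqs_four] using h
  · rintro ⟨a, ι⟩ - ⟨b, κ⟩ - h
    simpa [funext_iff, Fin.forall_fin_succ] using h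
  · intro f hf
    rw [mem_increasingSeqs_four] at hf
    refine ⟨(f 0, ![f 1, f 2, f 3]), by simpa using hf, ?_⟩
    ext i
    fin_cases i <;> simp

theorem twelve_mul_choose_four_add (m : ℕ) :
    12 * ((m + 4).choose 4 + (m + 3).choose 4) = (m + 3) * (m + 1) * (m + 2) ^ 2 := by
  have h1 := Nat.descFactorial_eq_factorial_mul_choose (m + 4) 4
  have h2 := Nat.descFactorial_eq_factorial_mul_choose (m + 3) 4
  simp [Nat.descFactorial_succ, Nat.factorial] at h1 h2
  nlinarith

/-- Pattern counts in `S_n(123,231,312)` for `n ≥ 3`: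
`f_{132} = f_{213} = C(n+1,4)` and `f_{321} = n(n−2)(n−1)²/12`. -/
theorem stmt_19 (n : ℕ) (hn : 3 ≤ n) :
    (fCnt n p132 [p123, p231, p312] = (n + 1).choose 4 ∧
     fCnt n p213 [p123, p231, p312] = (n + 1).choose 4) ∧
    12 * fCnt n p321 [p123, p231, p312] = n * (n - 2) * (n - 1) ^ 2 := by
  obtain ⟨m, rfl⟩ := Nat.exists_eq_add_of_le' hn
  simp only [fCnt_eq_card, pattern132_iff, pattern213_iff, pattern321_iff]
  refine ⟨⟨card_le_lt_lt _, card_lt_le_lt _⟩, ?_⟩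
  rw [Finset.filter_or, Finset.card_union_of_disjoint, card_lt_lt_le, card_lt_lt_lt]
  · exact twelve_mul_choose_four_add m
  · rw [Finset.disjoint_filter]
    rintro ⟨a, ι⟩ - ⟨h1, h2, h3⟩ ⟨h4, -, -⟩
    exact absurd (h4.trans (h1.trans h2)) h3.not_gt
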